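/- arXiv:1607.04096 — 2 statements merged into one kernel-verified Lean document; each statement's English description precedes it below -/
import Mathlib

section
/- Let r ≥ 2 and n ≥ 1 be integers, let D be a finite set with n elements, and let α be a system of weights of rank r on D which is weakly increasing (α_i(x) ≤ α_j(x) whenever i ≤ j) and concentrated, i.e. α_r(x) − α_1(x) < 4/(n r²) for every x ∈ D. Let d be an integer coprime to r. Then for all integers d' and r' with 0 < r' < r and all choices of subsets I(x) ⊆ {1,…,r} with |I(x)| = r' for each x ∈ D, the inequality d'·r − d·r' ≤ 0 holds if and only if (d'·r − d·r' : ℝ) < Σ_{x∈D} ( r·Σ_{i∈I(x)} α_i(x) − r'·Σ_{i=1}^r α_i(x) ). -/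
open Finset

/-- If a function takes values in `[m, M]`, then the rescaled difference between its sum over `s`
and its total sum is at most `|s| * |sᶜ| * (M - m)` in absolute value. -/
theorem abs_card_mul_sum_sub_card_mul_sum_le {ι : Type*} [Fintype ι]
    (f : ι → ℝ) {m M : ℝ} (hm : ∀ i, m ≤ f i) (hM : ∀ i, f i ≤ M) (s : Finset ι) :
    |(Fintype.card ι : ℝ) * ∑ i ∈ s, f i - (#s : ℝ) * ∑ i, f i| ≤
      (#s : ℝ) * ((Fintype.card ι : ℝ) - #s) * (M - m) := by
  classical
  have hsum : ∑ i, f i = ∑ i ∈ s, f i + ∑ i ∈ sᶜ, f i := (sum_add_sum_compl s f).symm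
  have hcard : (Fintype.card ι : ℝ) = #s + #sᶜ := by exact_mod_cast (card_add_card_compl s).symm
  have lower (t : Finset ι) : (#t : ℝ) * m ≤ ∑ i ∈ t, f i := by
    simpa using card_nsmul_le_sum t f m fun i _ => hm i
  have upper (t : Finset ι) : ∑ i ∈ t, f i ≤ (#t : ℝ) * M := by
    simpa using sum_le_card_nsmul t f M fun i _ => hM i
  have hs : (0 : ℝ) ≤ #s := Nat.cast_nonneg _
  have hc : (0 : ℝ) ≤ #sᶜ := Nat.cast_nonneg _
  have h₁ := mul_le_mul_of_nonneg_left (lower s) hc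
  have h₂ := mul_le_mul_of_nonneg_left (upper s) hc
  have h₃ := mul_le_mul_of_nonneg_left (lower sᶜ) hs
  have h₄ := mul_le_mul_of_nonneg_left (upper sᶜ) hs
  rw [hsum, hcard, abs_le]
  constructor <;> linarith

/-- The integer `d' * r - d * r'` does not vanish when `d` is coprime to `r` and `0 < r' < r`. -/
theorem mul_sub_mul_ne_zero_of_isCoprime {d d' : ℤ} {r r' : ℕ} (hcop : IsCoprime d (r : ℤ))
    (hpos : 0 < r') (hlt : r' < r) : d' * (r : ℤ) - d * (r' : ℤ) ≠ 0 := by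
  intro h
  have hdvd : (r : ℤ) ∣ d * r' := ⟨d', by linarith⟩
  have hle := Nat.le_of_dvd hpos (Int.natCast_dvd_natCast.mp (hcop.symm.dvd_of_dvd_mul_left hdvd))
  omega

/-- for a concentrated weakly increasing system of weights and
`gcd(d,r) = 1`, ordinary slope semi-stability of a subbundle of rank `r'` and degree
`d'` is equivalent to the parabolic stability inequality against the correction term
`Σ_{x∈D}( r·Σ_{i∈I(x)} α_i(x) − r'·Σ_{i=1}^r α_i(x) )`. -/
theorem concentrated_semistable_iff_parabolic_stable
    (r n : ℕ) (hr : 2 ≤ r) (hn : 1 ≤ n)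
    (D : Type*) [Fintype D] (hD : Fintype.card D = n)
    (α : D → Fin r → ℝ)
    (hmono : ∀ x : D, Monotone (α x))
    (hconc : ∀ x : D, α x ⟨r - 1, by omega⟩ - α x ⟨0, by omega⟩ < 4 / (n * r ^ 2))
    (d : ℤ) (hcop : IsCoprime d (r : ℤ)) :
    ∀ (d' : ℤ) (r' : ℕ), 0 < r' → r' < r →
      ∀ I : D → Finset (Fin r), (∀ x, (I x).card = r') →
        (d' * (r : ℤ) - d * (r' : ℤ) ≤ 0 ↔
          ((d' * (r : ℤ) - d * (r' : ℤ) : ℤ) : ℝ) <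
            ∑ x : D, ((r : ℝ) * ∑ i ∈ I x, α x i - (r' : ℝ) * ∑ i : Fin r, α x i)) := by
  intro d' r' hpos hlt I hI
  have hne := mul_sub_mul_ne_zero_of_isCoprime (d' := d') hcop hpos hlt
  have hr0 : (0 : ℝ) < r := by exact_mod_cast (by omega : 0 < r)
  have hn0 : (0 : ℝ) < n := by exact_mod_cast hn
  have hterm (x : D) :
      |(r : ℝ) * ∑ i ∈ I x, α x i - (r' : ℝ) * ∑ i : Fin r, α x i| < 1 / n := by
    have hmin (i : Fin r) : α x ⟨0, by omega⟩ ≤ α x i := hmono x (Fin.mk_le_of_le_val (Nat.zero_le _))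
    have hmax (i : Fin r) : α x i ≤ α x ⟨r - 1, by omega⟩ :=
      hmono x (Fin.le_def.mpr (Nat.le_sub_one_of_lt i.isLt))
    have hbound := abs_card_mul_sum_sub_card_mul_sum_le (α x) hmin hmax (I x)
    rw [hI x, Fintype.card_fin] at hbound
    have hquarter : (r' : ℝ) * (r - r') ≤ r ^ 2 / 4 := by nlinarith [sq_nonneg ((r : ℝ) - 2 * r')]
    calc _ ≤ _ := hbound
      _ ≤ (r : ℝ) ^ 2 / 4 * (α x ⟨r - 1, by omega⟩ - α x ⟨0, by omega⟩) :=
        mul_le_mul_of_nonneg_right hquarter (sub_nonneg.mpr (hmin _))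
      _ < (r : ℝ) ^ 2 / 4 * (4 / (n * r ^ 2)) :=
        mul_lt_mul_of_pos_left (hconc x) (by positivity)
      _ = 1 / n := by field_simp
  have hsum :
      |∑ x : D, ((r : ℝ) * ∑ i ∈ I x, α x i - (r' : ℝ) * ∑ i : Fin r, α x i)| < 1 := by
    have : Nonempty D := Fintype.card_pos_iff.mp (by omega)
    calc _ ≤ _ := abs_sum_le_sum_abs _ _
      _ < ∑ _x : D, (1 / n : ℝ) := sum_lt_sum_of_nonempty univ_nonempty fun x _ => hterm x
      _ = 1 := by simp [hD, hn0.ne']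
  obtain ⟨hlow, hupp⟩ := abs_lt.mp hsum
  constructor
  · intro h
    have hle : ((d' * (r : ℤ) - d * (r' : ℤ) : ℤ) : ℝ) ≤ -1 := by
      exact_mod_cast (by omega : d' * (r : ℤ) - d * (r' : ℤ) ≤ -1)
    linarith
  · intro h
    have hlt_one : ((d' * (r : ℤ) - d * (r' : ℤ) : ℤ) : ℝ) < 1 := h.trans hupp
    exact Int.lt_add_one_iff.mp (by exact_mod_cast hlt_one)
end

section
/- Let k ≥ 1 be an integer and let m_1, …, m_k be natural numbers with m_i ≥ 2 for every i. Let f : ℂ^k → ℂ be holomorphic (ℂ-differentiable on all of ℂ^k). Suppose that for every t ∈ ℂ with t ≠ 0 and every v = (v_1, …, v_k) ∈ ℂ^k one has f(t^{m_1} v_1, …, t^{m_k} v_k) = t · f(v_1, …, v_k). Then f is identically zero. -/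
/-- there is no nonzero holomorphic function on `ℂ^k` which is
homogeneous of degree one for a `ℂ*`-action `t·(v_1,…,v_k) = (t^{m_1}v_1,…,t^{m_k}v_k)`
whose exponents `m_i` are all at least two. -/
theorem no_degree_one_homogeneous_function
    (k : ℕ) (hk : 1 ≤ k) (m : Fin k → ℕ) (hm : ∀ i, 2 ≤ m i)
    (f : (Fin k → ℂ) → ℂ) (hf : Differentiable ℂ f)
    (hhom : ∀ t : ℂ, t ≠ 0 → ∀ v : Fin k → ℂ,
      f (fun i => t ^ m i * v i) = t * f v) :
    f = 0 := by
  funext v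
  have hγ : ∀ t : ℂ, HasDerivAt (fun t : ℂ => fun i => t ^ m i * v i)
      (fun i => (m i : ℂ) * t ^ (m i - 1) * v i) t := fun t =>
    hasDerivAt_pi.2 fun i => (hasDerivAt_pow (m i) t).mul_const (v i)
  have hγ_cont : Continuous (fun t : ℂ => fun i => t ^ m i * v i) :=
    continuous_iff_continuousAt.2 fun t => (hγ t).continuousAt
  have heq : (fun t : ℂ => f (fun i => t ^ m i * v i)) = fun t => t * f v :=
    Continuous.ext_on (dense_compl_singleton (0 : ℂ)) (hf.continuous.comp hγ_cont)
      (continuous_id.mul continuous_const) fun t ht => hhom t ht v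
  have hγ_zero : (fun i => (m i : ℂ) * 0 ^ (m i - 1) * v i) = 0 := by
    funext i
    have hi : m i - 1 ≠ 0 := by have := hm i; omega
    simp [zero_pow hi]
  have hcomp : HasDerivAt (fun t : ℂ => f (fun i => t ^ m i * v i)) 0 0 := by
    have h := (hf (fun i => (0 : ℂ) ^ m i * v i)).hasFDerivAt.comp_hasDerivAt 0 (hγ 0)
    rw [hγ_zero, map_zero] at h
    exact h
  rw [heq] at hcomp
  simpa using (((hasDerivAt_id (0 : ℂ)).mul_const (f v)).unique hcomp)
end
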